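/- arXiv:1001.5397 — 3 statements merged into one kernel-verified Lean document; each statement's English description precedes it below -/
import Mathlib

section
/- Let m2, m3 ∈ ℕ with gcd(m2, m3) = e, m2 = e·p2, m3 = e·p3, gcd(p2, p3) = 1. Every non-unit factor f of x2^{m3} − x3^{m2} in k[x2, x3] has the form a_{r·p3}·x2^{r·p3} + a_{(r−1)·p3}·x2^{(r−1)·p3}·x3^{p2} + … + a_{p3}·x2^{p3}·x3^{(r−1)·p2} + a_0·x3^{r·p2} for some r ∈ ℕ and coefficients a_i ∈ k with a_{r·p3} ≠ 0 and a_0 ≠ 0; in particular f is a polynomial in x2^{p3} and x3^{p2}. -/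
open MvPolynomial

/-- The weighting homomorphism `x_0 ↦ x_0 t^u`, `x_1 ↦ x_1 t^v`. -/
noncomputable def wtHom {k : Type*} [Field k] (u v : ℕ) :
    MvPolynomial (Fin 2) k →+* Polynomial (MvPolynomial (Fin 2) k) :=
  eval₂Hom (Polynomial.C.comp C)
    ![Polynomial.C (X 0) * Polynomial.X ^ u, Polynomial.C (X 1) * Polynomial.X ^ v]

lemma wtHom_monomial {k : Type*} [Field k] (u v : ℕ) (s : Fin 2 →₀ ℕ) (c : k) :
    wtHom u v (monomial s c) = Polynomial.monomial (u * s 0 + v * s 1) (monomial s c) := by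
  rw [wtHom, coe_eval₂Hom, eval₂_monomial, Finsupp.prod_fintype _ _ (by simp),
    ← Polynomial.C_mul_X_pow_eq_monomial, monomial_eq (s := s),
    Finsupp.prod_fintype _ _ (by simp)]
  simp only [Fin.prod_univ_two, Matrix.cons_val_zero, Matrix.cons_val_one, RingHom.comp_apply,
    map_mul, map_pow, mul_pow, pow_add, pow_mul]
  ring

lemma wtHom_coeff {k : Type*} [Field k] (u v : ℕ) (p : MvPolynomial (Fin 2) k)
    (s : Fin 2 →₀ ℕ) (n : ℕ) :
    coeff s ((wtHom u v p).coeff n) = if u * s 0 + v * s 1 = n then coeff s p else 0 := by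
  classical
  induction p using MvPolynomial.induction_on' with
  | monomial t c =>
    rw [wtHom_monomial, Polynomial.coeff_monomial]
    by_cases hts : t = s
    · subst hts
      split_ifs <;> simp
    · split_ifs <;> simp [hts]
  | add p q hp hq =>
    rw [map_add, Polynomial.coeff_add, coeff_add, hp, hq, coeff_add]
    split_ifs <;> simp

lemma exists_weight {k : Type*} [Field k] (u v N : ℕ) (f g F : MvPolynomial (Fin 2) k)
    (hF : F ≠ 0) (h : F = f * g) (hw : wtHom u v F = Polynomial.monomial N F) :
    ∃ d, ∀ s ∈ f.support, u * s 0 + v * s 1 = d := by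
  have hne : wtHom u v F ≠ 0 := by
    rw [hw]; simpa using hF
  have hmul : wtHom u v F = wtHom u v f * wtHom u v g := by rw [h, map_mul]
  have hf0 : wtHom u v f ≠ 0 := fun h0 => hne (by rw [hmul, h0, zero_mul])
  have hg0 : wtHom u v g ≠ 0 := fun h0 => hne (by rw [hmul, h0, mul_zero])
  have h1 : N = (wtHom u v f).natDegree + (wtHom u v g).natDegree := by
    rw [← Polynomial.natDegree_mul hf0 hg0, ← hmul, hw, Polynomial.natDegree_monomial_eq _ hF]
  have h2 : N = (wtHom u v f).natTrailingDegree + (wtHom u v g).natTrailingDegree := by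
    rw [← Polynomial.natTrailingDegree_mul hf0 hg0, ← hmul, hw,
      Polynomial.natTrailingDegree_monomial hF]
  have h3 := Polynomial.natTrailingDegree_le_natDegree (wtHom u v f)
  have h4 := Polynomial.natTrailingDegree_le_natDegree (wtHom u v g)
  refine ⟨(wtHom u v f).natDegree, fun s hs => ?_⟩
  have hc : (wtHom u v f).coeff (u * s 0 + v * s 1) ≠ 0 := by
    intro h0
    have := wtHom_coeff u v f s (u * s 0 + v * s 1)
    rw [h0, if_pos rfl, coeff_zero] at this
    exact (mem_support_iff.mp hs) this.symm
  have h5 := Polynomial.le_natDegree_of_ne_zero hc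
  have h6 := Polynomial.natTrailingDegree_le_of_ne_zero hc
  omega

lemma exists_pure {k : Type*} [Field k] (f : MvPolynomial (Fin 2) k) (x : Fin 2 → k)
    (i : Fin 2) (hx : x i = 0) (h : eval x f ≠ 0) : ∃ s ∈ f.support, s i = 0 := by
  rw [eval_eq'] at h
  obtain ⟨s, hs, hne⟩ := Finset.exists_ne_zero_of_sum_ne_zero h
  refine ⟨s, hs, ?_⟩
  by_contra h0
  exact hne (by
    rw [Finset.prod_eq_zero (Finset.mem_univ i) (by rw [hx, zero_pow h0]), mul_zero])

/-- Every non-unit factor of `x2^{m3} − x3^{m2}` in `k[x2,x3]` (with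
`gcd(m2,m3) = e`, `m2 = e·p2`, `m3 = e·p3`, `gcd(p2,p3) = 1`) has the form
`∑_{j=0}^{r} a_j·x2^{j·p3}·x3^{(r−j)·p2}` with `a_r ≠ 0` and `a_0 ≠ 0`. -/
theorem stmt_11 {k : Type*} [Field k] (m2 m3 e p2 p3 : ℕ)
    (hm2 : 0 < m2) (hm3 : 0 < m3)
    (he : Nat.gcd m2 m3 = e) (hp2 : m2 = e * p2) (hp3 : m3 = e * p3)
    (hcop : Nat.gcd p2 p3 = 1)
    (f : MvPolynomial (Fin 2) k)
    (hdvd : f ∣ (X 0 : MvPolynomial (Fin 2) k) ^ m3 - X 1 ^ m2)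
    (hf : ¬ IsUnit f) :
    ∃ r : ℕ, 0 < r ∧ ∃ a : ℕ → k, a r ≠ 0 ∧ a 0 ≠ 0 ∧
      f = ∑ j ∈ Finset.range (r + 1),
        C (a j) * (X 0 : MvPolynomial (Fin 2) k) ^ (j * p3) * X 1 ^ ((r - j) * p2) := by
  classical
  obtain ⟨g, hg⟩ := hdvd
  have hp2' : 0 < p2 := Nat.pos_of_ne_zero (by rintro rfl; omega)
  have hp3' : 0 < p3 := Nat.pos_of_ne_zero (by rintro rfl; omega)
  have e1 : eval ![(1 : k), 0] f ≠ 0 := by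
    intro h0
    have := congrArg (eval ![(1 : k), 0]) hg
    simp [h0, hm2.ne'] at this
  have e2 : eval ![(0 : k), 1] f ≠ 0 := by
    intro h0
    have := congrArg (eval ![(0 : k), 1]) hg
    simp [h0, hm3.ne'] at this
  have hF : (X 0 : MvPolynomial (Fin 2) k) ^ m3 - X 1 ^ m2 ≠ 0 := by
    intro h0
    have := congrArg (eval ![(1 : k), 0]) h0
    simp [hm2.ne'] at this
  have hw : wtHom p2 p3 ((X 0 : MvPolynomial (Fin 2) k) ^ m3 - X 1 ^ m2)
      = Polynomial.monomial (e * p2 * p3) (X 0 ^ m3 - X 1 ^ m2) := by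
    rw [X_pow_eq_monomial, X_pow_eq_monomial, map_sub, wtHom_monomial, wtHom_monomial, map_sub]
    congr 2 <;> congr 1 <;> simp [hp2, hp3] <;> ring
  obtain ⟨d, hd⟩ := exists_weight p2 p3 _ f g _ hF hg hw
  obtain ⟨s, hs, hs1⟩ := exists_pure f _ 1 rfl e1
  obtain ⟨t, ht, ht0⟩ := exists_pure f _ 0 rfl e2
  have hsd := hd s hs
  have htd := hd t ht
  rw [hs1, mul_zero, add_zero] at hsd
  rw [ht0, mul_zero, zero_add] at htd
  have hdv : p2 * p3 ∣ d :=
    Nat.Coprime.mul_dvd_of_dvd_of_dvd hcop ⟨_, hsd.symm⟩ ⟨_, htd.symm⟩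
  obtain ⟨r, rfl⟩ := hdv
  have hs0 : s 0 = r * p3 := by
    apply Nat.eq_of_mul_eq_mul_left hp2'; rw [hsd]; ring
  have ht1 : t 1 = r * p2 := by
    apply Nat.eq_of_mul_eq_mul_left hp3'; rw [htd]; ring
  let σ : ℕ → (Fin 2 →₀ ℕ) := fun j =>
    Finsupp.single 0 (j * p3) + Finsupp.single 1 ((r - j) * p2)
  have σ0 : ∀ j, σ j 0 = j * p3 := fun j => by simp [σ]
  have σ1 : ∀ j, σ j 1 = (r - j) * p2 := fun j => by simp [σ]
  have hext : ∀ a b : Fin 2 →₀ ℕ, a 0 = b 0 → a 1 = b 1 → a = b := by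
    intro a b h0 h1
    ext i
    fin_cases i
    · exact h0
    · exact h1
  have hσs : s = σ r := hext _ _ (by rw [σ0, hs0]) (by rw [σ1, hs1]; simp)
  have hσt : t = σ 0 := hext _ _ (by rw [σ0, ht0]; simp) (by rw [σ1, ht1]; simp)
  have hsupp : ∀ q ∈ f.support, ∃ j ∈ Finset.range (r + 1), q = σ j := by
    intro q hq
    have h := hd q hq
    have h3 : p3 ∣ p2 * q 0 := by
      rw [Nat.dvd_add_iff_left (Dvd.intro (q 1) rfl : p3 ∣ p3 * q 1), h]
      exact ⟨p2 * r, by ring⟩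
    obtain ⟨j, hj⟩ := (Nat.Coprime.symm hcop).dvd_of_dvd_mul_left h3
    have h' : p2 * j + q 1 = p2 * r := by
      apply Nat.eq_of_mul_eq_mul_left hp3'
      rw [hj] at h
      linarith
    have hjr : j ≤ r := by
      apply Nat.le_of_mul_le_mul_left _ hp2'
      omega
    refine ⟨j, by simpa [Nat.lt_succ_iff] using hjr, hext _ _ ?_ ?_⟩
    · rw [σ0, hj, mul_comm]
    · rw [σ1, Nat.sub_mul, mul_comm r, mul_comm j]
      omega
  have hfeq : f = ∑ j ∈ Finset.range (r + 1),
        C (coeff (σ j) f) * (X 0 : MvPolynomial (Fin 2) k) ^ (j * p3)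
          * X 1 ^ ((r - j) * p2) := by
    have hterm : ∀ j, C (coeff (σ j) f) * (X 0 : MvPolynomial (Fin 2) k) ^ (j * p3)
          * X 1 ^ ((r - j) * p2) = monomial (σ j) (coeff (σ j) f) := by
      intro j
      rw [X_pow_eq_monomial, X_pow_eq_monomial, C_mul_monomial, monomial_mul]
      simp [σ]
    simp_rw [hterm]
    have hinj : ∀ i j, σ i = σ j → i = j := by
      intro i j hij
      have := congrArg (fun a => a 0) hij
      simp only [σ0] at this
      exact Nat.eq_of_mul_eq_mul_right hp3' this
    ext q
    rw [coeff_sum]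
    simp_rw [coeff_monomial]
    by_cases hq : q ∈ f.support
    · obtain ⟨j, hj, rfl⟩ := hsupp q hq
      rw [Finset.sum_eq_single_of_mem j hj]
      · simp
      · intro b _ hb
        rw [if_neg (fun h => hb (hinj _ _ h))]
    · rw [notMem_support_iff.mp hq]
      symm
      apply Finset.sum_eq_zero
      intro j _
      split_ifs with h
      · rw [h]; exact notMem_support_iff.mp hq
      · rfl
  have ha0 : coeff (σ 0) f ≠ 0 := by rw [← hσt]; exact mem_support_iff.mp ht
  refine ⟨r, ?_, fun j => coeff (σ j) f, ?_, ha0, hfeq⟩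
  · rcases Nat.eq_zero_or_pos r with rfl | h
    · exfalso
      apply hf
      rw [hfeq]
      simpa using ha0
    · exact h
  · show coeff (σ r) f ≠ 0
    rw [← hσs]; exact mem_support_iff.mp hs
end

section
/- For a Herzog–Northcott ideal I in k[x1,x2,x3], the Herzog ideal 𝔭_{m(I)} associated to the vector m(I) = (c2·c3 − a2·b3, c1·c3 − a3·b1, c1·c2 − a1·b2) contains I, and it is the unique Herzog ideal containing I; in particular 𝔭_{m(I)} is a minimal prime of I. -/
open MvPolynomial

/-- The Herzog ideal associated to `n ∈ ℕ^3`: the kernel of the `k`-algebra map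
`k[x1,x2,x3] → k[t]` sending `xᵢ` to `t^{nᵢ}`. -/
noncomputable def herzogIdeal (k : Type*) [Field k] (n : Fin 3 → ℕ) :
    Ideal (MvPolynomial (Fin 3) k) :=
  RingHom.ker (MvPolynomial.aeval (fun i => (Polynomial.X : Polynomial k) ^ n i)).toRingHom

lemma mem_herzog {k : Type*} [Field k] (n : Fin 3 → ℕ) (f : MvPolynomial (Fin 3) k) :
    f ∈ herzogIdeal k n ↔
      MvPolynomial.aeval (fun i => (Polynomial.X : Polynomial k) ^ n i) f = 0 := Iff.rfl

lemma herzog_smul {k : Type*} [Field k] (n : Fin 3 → ℕ) (d : ℕ) (hd : 0 < d) :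
    herzogIdeal k (fun i => d * n i) = herzogIdeal k n := by
  ext f
  rw [mem_herzog, mem_herzog]
  have h : (MvPolynomial.aeval (fun i => (Polynomial.X : Polynomial k) ^ (d * n i)))
      = (Polynomial.expand k d).comp
        (MvPolynomial.aeval (fun i => (Polynomial.X : Polynomial k) ^ n i)) := by
    apply MvPolynomial.algHom_ext
    intro i
    simp [pow_mul]
  rw [h, AlgHom.comp_apply]
  exact map_eq_zero_iff _ (Polynomial.expand_injective hd)

lemma herzog_binom {k : Type*} [Field k] (n : Fin 3 → ℕ) (i j l : Fin 3) (p q r : ℕ) :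
    (X i : MvPolynomial (Fin 3) k) ^ p - X j ^ q * X l ^ r ∈ herzogIdeal k n ↔
      n i * p = n j * q + n l * r := by
  rw [mem_herzog]
  simp only [map_sub, map_pow, map_mul, aeval_X, ← pow_mul, ← pow_add, sub_eq_zero]
  constructor
  · intro h
    have := congrArg Polynomial.natDegree h
    simpa using this
  · intro h
    rw [h]

lemma herzog_min {k : Type*} [Field k] (m : Fin 3 → ℕ) (hm : ∀ i, 0 < m i)
    (P : Ideal (MvPolynomial (Fin 3) k)) (hP : P.IsPrime) (hle : P ≤ herzogIdeal k m)
    (h1 : ∃ N, (X 1 : MvPolynomial (Fin 3) k) ^ m 0 - X 0 ^ N ∈ P)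
    (h2 : ∃ N, (X 2 : MvPolynomial (Fin 3) k) ^ m 0 - X 0 ^ N ∈ P) :
    herzogIdeal k m ≤ P := by
  intro f hf
  let φ : Polynomial k →ₐ[k] (MvPolynomial (Fin 3) k ⧸ P) :=
    Polynomial.aeval (Ideal.Quotient.mk P (X 0))
  letI : Algebra (Polynomial k) (MvPolynomial (Fin 3) k ⧸ P) := φ.toRingHom.toAlgebra
  have hφ : ∀ g, algebraMap (Polynomial k) (MvPolynomial (Fin 3) k ⧸ P) g = φ g := fun _ => rfl
  have hX0 : ∀ N, IsIntegral (Polynomial k) (Ideal.Quotient.mk P (X 0 ^ N)) := by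
    intro N
    have : Ideal.Quotient.mk P (X 0 ^ N) = algebraMap (Polynomial k) _ (Polynomial.X ^ N) := by
      rw [hφ]; simp [φ]
    rw [this]
    exact isIntegral_algebraMap
  have aux : ∀ i, (∃ N, (X i : MvPolynomial (Fin 3) k) ^ m 0 - X 0 ^ N ∈ P) →
      IsIntegral (Polynomial k) (Ideal.Quotient.mk P (X i)) := by
    rintro i ⟨N, hN⟩
    apply IsIntegral.of_pow (hm 0)
    rw [← map_pow, Ideal.Quotient.eq.mpr hN]
    exact hX0 N
  have hXi : ∀ i, IsIntegral (Polynomial k) (Ideal.Quotient.mk P (X i)) := by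
    intro i
    fin_cases i
    · simpa using hX0 1
    · exact aux 1 h1
    · exact aux 2 h2
  have hint : ∀ g : MvPolynomial (Fin 3) k,
      IsIntegral (Polynomial k) (Ideal.Quotient.mk P g) := by
    intro g
    induction g using MvPolynomial.induction_on with
    | C a =>
      have : Ideal.Quotient.mk P (C a) = algebraMap (Polynomial k) _ (Polynomial.C a) := by
        rw [hφ]; simp only [φ, Polynomial.aeval_C]; rfl
      rw [this]
      exact isIntegral_algebraMap
    | add p q hp hq => rw [map_add]; exact hp.add hq
    | mul_X p i hp => rw [map_mul]; exact hp.mul (hXi i)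
  let ψ : (MvPolynomial (Fin 3) k ⧸ P) →ₐ[k] Polynomial k :=
    Ideal.Quotient.liftₐ P (MvPolynomial.aeval (fun i => (Polynomial.X : Polynomial k) ^ m i))
      (fun a ha => (mem_herzog m a).1 (hle ha))
  have hψφ : ψ.comp φ = Polynomial.expand k (m 0) := by
    apply Polynomial.algHom_ext
    have h3 : ψ (Ideal.Quotient.mk P (X 0)) =
        MvPolynomial.aeval (fun i => (Polynomial.X : Polynomial k) ^ m i) (X 0) := rfl
    rw [aeval_X] at h3
    simp [φ, h3]
  by_contra hfP
  have hlt := Ideal.comap_lt_comap_of_integral_mem_sdiff (R := Polynomial k)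
    (I := (⊥ : Ideal (MvPolynomial (Fin 3) k ⧸ P))) (J := RingHom.ker ψ.toRingHom) bot_le
    (x := Ideal.Quotient.mk P f)
    ⟨(mem_herzog m f).1 hf, fun h => hfP (Ideal.Quotient.eq_zero_iff_mem.1 h)⟩ (hint f)
  obtain ⟨g, hg, hg'⟩ := SetLike.exists_of_lt hlt
  apply hg'
  have h0 : (ψ.comp φ) g = 0 := hg
  rw [hψφ] at h0
  have : g = 0 := (map_eq_zero_iff _ (Polynomial.expand_injective (hm 0))).1 h0
  rw [this]
  exact Ideal.zero_mem _

lemma herzog_prime {k : Type*} [Field k] (m : Fin 3 → ℕ) : (herzogIdeal k m).IsPrime :=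
  RingHom.ker_isPrime _

lemma herzog_X {k : Type*} [Field k] (m : Fin 3 → ℕ) (i : Fin 3) (N : ℕ) :
    (X i : MvPolynomial (Fin 3) k) ^ N ∉ herzogIdeal k m := by
  rw [mem_herzog]
  simp

/-- The Herzog ideal `𝔭_{m(I)}` contains the Herzog–Northcott ideal `I`, it is
the unique Herzog ideal containing `I`, and it is a minimal prime of `I`. -/
theorem stmt_16 {k : Type*} [Field k]
    (a1 a2 a3 b1 b2 b3 c1 c2 c3 : ℕ)
    (ha1 : 0 < a1) (ha2 : 0 < a2) (ha3 : 0 < a3)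
    (hb1 : 0 < b1) (hb2 : 0 < b2) (hb3 : 0 < b3)
    (hc1 : c1 = a1 + b1) (hc2 : c2 = a2 + b2) (hc3 : c3 = a3 + b3)
    (I : Ideal (MvPolynomial (Fin 3) k))
    (hI : I = Ideal.span {(X 0 : MvPolynomial (Fin 3) k) ^ c1 - X 1 ^ b2 * X 2 ^ a3,
      X 1 ^ c2 - X 0 ^ a1 * X 2 ^ b3, X 2 ^ c3 - X 0 ^ b1 * X 1 ^ a2})
    (mI : Fin 3 → ℕ)
    (hmI : mI = ![c2 * c3 - a2 * b3, c1 * c3 - a3 * b1, c1 * c2 - a1 * b2]) :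
    I ≤ herzogIdeal k mI ∧
    (∀ n : Fin 3 → ℕ, (∀ i, 0 < n i) → I ≤ herzogIdeal k n →
      herzogIdeal k n = herzogIdeal k mI) ∧
    herzogIdeal k mI ∈ I.minimalPrimes := by
  have e1 : mI 0 = a2 * a3 + b2 * a3 + b2 * b3 := by
    simp only [hmI, hc2, hc3, Matrix.cons_val]
    rw [Nat.sub_eq_iff_eq_add (by nlinarith)]; ring
  have e2 : mI 1 = a1 * a3 + a1 * b3 + b1 * b3 := by
    simp only [hmI, hc1, hc3, Matrix.cons_val]
    rw [Nat.sub_eq_iff_eq_add (by nlinarith)]; ring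
  have e3 : mI 2 = a1 * a2 + b1 * a2 + b1 * b2 := by
    simp only [hmI, hc1, hc2, Matrix.cons_val]
    rw [Nat.sub_eq_iff_eq_add (by nlinarith)]; ring
  have key : ∀ n : Fin 3 → ℕ, I ≤ herzogIdeal k n ↔
      (n 0 * c1 = n 1 * b2 + n 2 * a3 ∧ n 1 * c2 = n 0 * a1 + n 2 * b3 ∧
        n 2 * c3 = n 0 * b1 + n 1 * a2) := by
    intro n
    rw [hI, Ideal.span_le]
    simp only [Set.insert_subset_iff, Set.singleton_subset_iff, SetLike.mem_coe, herzog_binom]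
  have hpos : ∀ i, 0 < mI i := by
    intro i
    fin_cases i
    · change 0 < mI 0
      rw [e1]; positivity
    · change 0 < mI 1
      rw [e2]; positivity
    · change 0 < mI 2
      rw [e3]; positivity
  have hle : I ≤ herzogIdeal k mI := by
    rw [key, e1, e2, e3, hc1, hc2, hc3]
    refine ⟨?_, ?_, ?_⟩ <;> ring
  refine ⟨hle, ?_, ⟨herzog_prime mI, hle⟩, ?_⟩
  · intro n hn hIn
    rw [key] at hIn
    obtain ⟨q1, q2, q3⟩ := hIn
    have r1 : n 0 * mI 1 = mI 0 * n 1 := by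
      rw [e1, e2]
      subst hc1 hc2 hc3
      zify at *
      linear_combination b3 * q1 - a3 * q2
    have r2 : n 0 * mI 2 = mI 0 * n 2 := by
      rw [e1, e3]
      subst hc1 hc2 hc3
      zify at *
      linear_combination a2 * q1 - b2 * q3
    rw [← herzog_smul n (mI 0) (hpos 0), ← herzog_smul mI (n 0) (hn 0)]
    congr 1
    funext i
    fin_cases i
    · exact mul_comm _ _
    · exact r1.symm
    · exact r2.symm
  · rintro P ⟨hP, hIP⟩ hPm
    have hX : ∀ i N, (X i : MvPolynomial (Fin 3) k) ^ N ∉ P :=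
      fun i N h => herzog_X mI i N (hPm h)
    have g1 : (X 0 : MvPolynomial (Fin 3) k) ^ c1 - X 1 ^ b2 * X 2 ^ a3 ∈ P :=
      hIP (hI ▸ Ideal.subset_span (by simp))
    have g2 : (X 1 : MvPolynomial (Fin 3) k) ^ c2 - X 0 ^ a1 * X 2 ^ b3 ∈ P :=
      hIP (hI ▸ Ideal.subset_span (by simp))
    have g3 : (X 2 : MvPolynomial (Fin 3) k) ^ c3 - X 0 ^ b1 * X 1 ^ a2 ∈ P :=
      hIP (hI ▸ Ideal.subset_span (by simp))
    rw [← Ideal.Quotient.eq] at g1 g2 g3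
    simp only [map_pow, map_mul] at g1 g2 g3
    have hX' : ∀ i N, (Ideal.Quotient.mk P (X i)) ^ N ≠ 0 := by
      intro i N h
      rw [← map_pow] at h
      exact hX i N (Ideal.Quotient.eq_zero_iff_mem.1 h)
    refine herzog_min mI hpos P hP hPm ⟨mI 1, ?_⟩ ⟨mI 2, ?_⟩
    · rw [← Ideal.Quotient.eq]
      simp only [map_pow]
      apply mul_right_cancel₀ (hX' 2 (a3 * b3))
      generalize Ideal.Quotient.mk P (X 0) = x at *
      generalize Ideal.Quotient.mk P (X 1) = y at *
      generalize Ideal.Quotient.mk P (X 2) = z at *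
      calc y ^ mI 0 * z ^ (a3 * b3) = (y ^ b2 * z ^ a3) ^ b3 * (y ^ c2) ^ a3 := by
            rw [e1, hc2]; ring
        _ = (x ^ c1) ^ b3 * (x ^ a1 * z ^ b3) ^ a3 := by rw [g1, g2]
        _ = x ^ mI 1 * z ^ (a3 * b3) := by rw [e2, hc1]; ring
    · rw [← Ideal.Quotient.eq]
      simp only [map_pow]
      apply mul_right_cancel₀ (hX' 1 (a2 * b2))
      generalize Ideal.Quotient.mk P (X 0) = x at *
      generalize Ideal.Quotient.mk P (X 1) = y at *
      generalize Ideal.Quotient.mk P (X 2) = z at *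
      calc z ^ mI 0 * y ^ (a2 * b2) = (y ^ b2 * z ^ a3) ^ a2 * (z ^ c3) ^ b2 := by
            rw [e1, hc3]; ring
        _ = (x ^ c1) ^ a2 * (x ^ b1 * y ^ a2) ^ b2 := by rw [g1, g3]
        _ = x ^ mI 2 * y ^ (a2 * b2) := by rw [e3, hc1]; ring
end

section
/- A Herzog–Northcott ideal I in k[x1,x2,x3] is prime if and only if gcd(m1, m2, m3) = 1, where (m1, m2, m3) = (c2·c3 − a2·b3, c1·c3 − a3·b1, c1·c2 − a1·b2); and in that case I equals the Herzog ideal 𝔭_{(m1,m2,m3)}. -/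
open MvPolynomial

/-- Core combinatorial lemma: in a ring where the three relations hold, monomials whose
exponents differ by an element of the lattice agree. -/
theorem hn_core {R : Type*} [CommRing R] (x y z : R) (a1 a2 a3 b1 b2 b3 : ℕ)
    (h1 : x ^ (a1 + b1) = y ^ b2 * z ^ a3) (h2 : y ^ (a2 + b2) = x ^ a1 * z ^ b3)
    (h3 : z ^ (a3 + b3) = x ^ b1 * y ^ a2) :
    ∀ (n α β γ : ℕ), α + β + γ = n → ∀ u1 u2 u3 v1 v2 v3 : ℕ,
      u1 + β * a1 + γ * b1 = v1 + α * (a1 + b1) →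
      u2 + α * b2 + γ * a2 = v2 + β * (a2 + b2) →
      u3 + α * a3 + β * b3 = v3 + γ * (a3 + b3) →
      x ^ u1 * y ^ u2 * z ^ u3 = x ^ v1 * y ^ v2 * z ^ v3 := by
  intro n
  induction n using Nat.strong_induction_on with
  | _ n ih =>
  intro α β γ hn u1 u2 u3 v1 v2 v3 e1 e2 e3
  have mm : ∀ {p q : ℕ} (r : ℕ), p < q → p * r + r ≤ q * r := by
    intro p q r h
    have := Nat.mul_le_mul_right r (Nat.succ_le_of_lt h)
    rwa [Nat.succ_mul] at this
  rcases lt_trichotomy α β with hab | hab | hab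
  · rcases lt_trichotomy β γ with hbg | hbg | hbg
    · -- γ max
      obtain ⟨w, rfl⟩ : ∃ w, u3 = w + (a3 + b3) :=
        ⟨u3 - (a3 + b3), by have := mm a3 (hab.trans hbg); have := mm b3 hbg; rw [mul_add] at e3; omega⟩
      obtain ⟨g, rfl⟩ : ∃ g, γ = g + 1 := ⟨γ - 1, by omega⟩
      rw [← ih (α + β + g) (by omega) α β g rfl (u1 + b1) (u2 + a2) w v1 v2 v3
        (by linarith) (by linarith) (by linarith), pow_add z, h3]; ring
    · -- β = γ > α
      subst hbg
      obtain ⟨w2, rfl⟩ : ∃ w, u2 = w + b2 :=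
        ⟨u2 - b2, by have := mm b2 hab; rw [mul_add] at e2; omega⟩
      obtain ⟨w3, rfl⟩ : ∃ w, u3 = w + a3 :=
        ⟨u3 - a3, by have := mm a3 hab; rw [mul_add] at e3; omega⟩
      obtain ⟨g, rfl⟩ : ∃ g, β = g + 1 := ⟨β - 1, by omega⟩
      rw [← ih (α + g + g) (by omega) α g g rfl (u1 + (a1 + b1)) w2 w3 v1 v2 v3
        (by linarith) (by linarith) (by linarith), pow_add x u1, h1]; ring
    · obtain ⟨w, rfl⟩ : ∃ w, u2 = w + (a2 + b2) :=
        ⟨u2 - (a2 + b2), by have := mm b2 hab; have := mm a2 hbg; rw [mul_add] at e2; omega⟩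
      obtain ⟨g, rfl⟩ : ∃ g, β = g + 1 := ⟨β - 1, by omega⟩
      rw [← ih (α + g + γ) (by omega) α g γ rfl (u1 + a1) w (u3 + b3) v1 v2 v3
        (by linarith) (by linarith) (by linarith), pow_add y, h2]; ring
  · subst hab
    rcases lt_trichotomy α γ with hbg | hbg | hbg
    · obtain ⟨w, rfl⟩ : ∃ w, u3 = w + (a3 + b3) :=
        ⟨u3 - (a3 + b3), by have := mm a3 hbg; have := mm b3 hbg; rw [mul_add] at e3; omega⟩
      obtain ⟨g, rfl⟩ : ∃ g, γ = g + 1 := ⟨γ - 1, by omega⟩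
      rw [← ih (α + α + g) (by omega) α α g rfl (u1 + b1) (u2 + a2) w v1 v2 v3
        (by linarith) (by linarith) (by linarith), pow_add z, h3]; ring
    · subst hbg
      obtain rfl : u1 = v1 := by rw [mul_add] at e1; omega
      obtain rfl : u2 = v2 := by rw [mul_add] at e2; omega
      obtain rfl : u3 = v3 := by rw [mul_add] at e3; omega
      rfl
    · obtain ⟨w1, rfl⟩ : ∃ w, u1 = w + b1 :=
        ⟨u1 - b1, by have := mm b1 hbg; rw [mul_add] at e1; omega⟩
      obtain ⟨w2, rfl⟩ : ∃ w, u2 = w + a2 :=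
        ⟨u2 - a2, by have := mm a2 hbg; rw [mul_add] at e2; omega⟩
      obtain ⟨g, rfl⟩ : ∃ g, α = g + 1 := ⟨α - 1, by omega⟩
      rw [← ih (g + g + γ) (by omega) g g γ rfl w1 w2 (u3 + (a3 + b3)) v1 v2 v3
        (by linarith) (by linarith) (by linarith), pow_add z u3, h3]; ring
  · rcases lt_trichotomy α γ with hbg | hbg | hbg
    · obtain ⟨w, rfl⟩ : ∃ w, u3 = w + (a3 + b3) :=
        ⟨u3 - (a3 + b3), by have := mm a3 hbg; have := mm b3 (hab.trans hbg); rw [mul_add] at e3; omega⟩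
      obtain ⟨g, rfl⟩ : ∃ g, γ = g + 1 := ⟨γ - 1, by omega⟩
      rw [← ih (α + β + g) (by omega) α β g rfl (u1 + b1) (u2 + a2) w v1 v2 v3
        (by linarith) (by linarith) (by linarith), pow_add z, h3]; ring
    · subst hbg
      obtain ⟨w1, rfl⟩ : ∃ w, u1 = w + a1 :=
        ⟨u1 - a1, by have := mm a1 hab; rw [mul_add] at e1; omega⟩
      obtain ⟨w3, rfl⟩ : ∃ w, u3 = w + b3 :=
        ⟨u3 - b3, by have := mm b3 hab; rw [mul_add] at e3; omega⟩
      obtain ⟨g, rfl⟩ : ∃ g, α = g + 1 := ⟨α - 1, by omega⟩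
      rw [← ih (g + β + g) (by omega) g β g rfl w1 (u2 + (a2 + b2)) w3 v1 v2 v3
        (by linarith) (by linarith) (by linarith), pow_add y u2, h2]; ring
    · obtain ⟨w, rfl⟩ : ∃ w, u1 = w + (a1 + b1) :=
        ⟨u1 - (a1 + b1), by have := mm a1 hab; have := mm b1 hbg; rw [mul_add] at e1; omega⟩
      obtain ⟨g, rfl⟩ : ∃ g, α = g + 1 := ⟨α - 1, by omega⟩
      rw [← ih (g + β + γ) (by omega) g β γ rfl w (u2 + b2) (u3 + a3) v1 v2 v3
        (by linarith) (by linarith) (by linarith), pow_add x, h1]; ring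

/-- Integer version of the core lemma. -/
theorem hn_core_int {R : Type*} [CommRing R] (x y z : R) (a1 a2 a3 b1 b2 b3 : ℕ)
    (h1 : x ^ (a1 + b1) = y ^ b2 * z ^ a3) (h2 : y ^ (a2 + b2) = x ^ a1 * z ^ b3)
    (h3 : z ^ (a3 + b3) = x ^ b1 * y ^ a2) (α β : ℤ) (u1 u2 u3 v1 v2 v3 : ℕ)
    (e1 : (u1 : ℤ) - v1 = α * (a1 + b1) - β * a1)
    (e2 : (u2 : ℤ) - v2 = - α * b2 + β * (a2 + b2))
    (e3 : (u3 : ℤ) - v3 = - α * a3 - β * b3) :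
    x ^ u1 * y ^ u2 * z ^ u3 = x ^ v1 * y ^ v2 * z ^ v3 := by
  obtain ⟨t, A, B, hA, hB⟩ : ∃ t A B : ℕ, α + t = A ∧ β + t = B :=
    ⟨α.natAbs + β.natAbs, (α + (α.natAbs + β.natAbs)).toNat, (β + (α.natAbs + β.natAbs)).toNat,
      by omega, by omega⟩
  obtain rfl : α = A - t := by linarith
  obtain rfl : β = B - t := by linarith
  refine hn_core x y z a1 a2 a3 b1 b2 b3 h1 h2 h3 _ A B t rfl _ _ _ _ _ _ ?_ ?_ ?_
  · zify; linarith
  · zify; linarith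
  · zify; linarith

/-- Kernel of the monomial map is contained in `I`. -/
theorem hn_ker_le {k : Type*} [Field k] (I : Ideal (MvPolynomial (Fin 3) k)) (m : Fin 3 → ℕ)
    (H : ∀ u v : Fin 3 →₀ ℕ, u 0 * m 0 + u 1 * m 1 + u 2 * m 2 = v 0 * m 0 + v 1 * m 1 + v 2 * m 2 →
      (monomial u (1 : k)) - monomial v 1 ∈ I) : herzogIdeal k m ≤ I := by
  classical
  let deg : (Fin 3 →₀ ℕ) → ℕ := fun u => u 0 * m 0 + u 1 * m 1 + u 2 * m 2
  let φ : MvPolynomial (Fin 3) k →ₐ[k] Polynomial k :=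
    MvPolynomial.aeval (fun i => (Polynomial.X : Polynomial k) ^ m i)
  let ψ : Polynomial k →ₗ[k] (MvPolynomial (Fin 3) k ⧸ I) :=
    (Polynomial.basisMonomials k).constr k
      (fun n => Ideal.Quotient.mk I (monomial (Function.invFun deg n) 1))
  have key : ψ ∘ₗ φ.toLinearMap = (Ideal.Quotient.mkₐ k I).toLinearMap := by
    apply MvPolynomial.linearMap_ext
    intro u
    ext
    have e : φ (monomial u 1) = Polynomial.basisMonomials k (deg u) := by
      simp only [φ, aeval_monomial, Polynomial.coe_basisMonomials, map_one, one_mul]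
      rw [Finsupp.prod_fintype _ _ (by simp)]
      simp only [Fin.prod_univ_three, ← pow_mul, ← pow_add, ← Polynomial.X_pow_eq_monomial, deg]
      congr 1; ring
    simp only [LinearMap.comp_apply, AlgHom.toLinearMap_apply, e, ψ, Module.Basis.constr_basis]
    refine Ideal.Quotient.eq.mpr (H _ _ ?_)
    exact Function.invFun_eq (f := deg) ⟨u, rfl⟩
  intro f hf
  have hf' : φ f = 0 := hf
  have := LinearMap.congr_fun key f
  simp only [LinearMap.comp_apply, AlgHom.toLinearMap_apply, hf', map_zero] at this
  exact Ideal.Quotient.eq_zero_iff_mem.mp this.symm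

/-- Primeness implies that the group is torsion free, abstractly. -/
theorem hn_tors {k : Type*} [Field k] {G : Type*} [AddCommGroup G] (g : Fin 3 → G)
    (I : Ideal (MvPolynomial (Fin 3) k)) (hP : I.IsPrime)
    (hI : ∀ f ∈ I, MvPolynomial.aeval (fun i => (AddMonoidAlgebra.single (g i) (1 : k))) f = 0)
    (X Y : MvPolynomial (Fin 3) k) (p q : G)
    (hX : MvPolynomial.aeval (fun i => (AddMonoidAlgebra.single (g i) (1 : k))) X
      = AddMonoidAlgebra.single p 1)
    (hY : MvPolynomial.aeval (fun i => (AddMonoidAlgebra.single (g i) (1 : k))) Y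
      = AddMonoidAlgebra.single q 1)
    (hN : ∀ N : ℕ, N • p = N • q → X ^ N - Y ^ N ∈ I)
    (n : ℕ) (hn : 0 < n) (hnp : n • p = n • q) : p = q := by
  classical
  have hfin : IsOfFinAddOrder (p - q) :=
    isOfFinAddOrder_iff_nsmul_eq_zero.mpr ⟨n, hn, by rw [nsmul_sub, hnp, sub_self]⟩
  have hNpos := hfin.addOrderOf_pos
  set N := addOrderOf (p - q) with hNdef
  have hNe : N • p = N • q := by
    have := addOrderOf_nsmul_eq_zero (p - q)
    rwa [nsmul_sub, sub_eq_zero] at this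
  have h := hN N hNe
  rw [← Commute.geom_sum₂_mul (Commute.all X Y)] at h
  rcases hP.mem_or_mem h with h | h
  · exfalso
    have h0 := hI _ h
    simp only [map_sum, map_mul, map_pow, hX, hY, AddMonoidAlgebra.single_pow, one_pow,
      AddMonoidAlgebra.single_mul_single, mul_one] at h0
    have h1 := congrArg (fun F : AddMonoidAlgebra k G => F.coeff ((N - 1) • p)) h0
    simp only [AddMonoidAlgebra.coeff_sum, Finsupp.finsetSum_apply, AddMonoidAlgebra.coeff_single,
      AddMonoidAlgebra.coeff_zero, Finsupp.coe_zero, Pi.zero_apply] at h1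
    rw [Finset.sum_eq_single (N - 1)] at h1
    · simp at h1
    · intro i hi hne
      rw [Finset.mem_range] at hi
      apply Finsupp.single_eq_of_ne
      intro hc
      have hc' : (N - 1 - i) • (p - q) = 0 := by
        have e : (N - 1) • p = i • p + (N - 1 - i) • p := by
          rw [← add_nsmul]; congr 1; omega
        rw [e, add_right_inj] at hc
        rw [nsmul_sub, hc, sub_self]
      have hd := addOrderOf_dvd_of_nsmul_eq_zero hc'
      have := Nat.le_of_dvd (by omega) hd
      omega
    · intro hc
      exact absurd (Finset.mem_range.mpr (by omega)) hc
  · have h0 := hI _ h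
    rw [map_sub, hX, hY, sub_eq_zero] at h0
    exact (AddMonoidAlgebra.single_left_inj one_ne_zero).mp h0

/-- The lattice attached to a Herzog–Northcott ideal. -/
def hnLattice (a1 a2 a3 b1 b2 b3 : ℕ) : AddSubgroup (ℤ × ℤ × ℤ) where
  carrier := {d | ∃ α β : ℤ, d.1 = α * (a1 + b1) - β * a1 ∧
    d.2.1 = - α * b2 + β * (a2 + b2) ∧ d.2.2 = - α * a3 - β * b3}
  zero_mem' := ⟨0, 0, by simp⟩
  add_mem' := by
    rintro x y ⟨α, β, h1, h2, h3⟩ ⟨α_b, β_b, h1b, h2b, h3b⟩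
    refine ⟨α + α_b, β + β_b, ?_, ?_, ?_⟩
    · rw [Prod.fst_add, h1, h1b]; ring
    · rw [Prod.snd_add, Prod.fst_add, h2, h2b]; ring
    · rw [Prod.snd_add, Prod.snd_add, h3, h3b]; ring
  neg_mem' := by
    rintro x ⟨α, β, h1, h2, h3⟩
    refine ⟨-α, -β, ?_, ?_, ?_⟩
    · rw [Prod.fst_neg, h1]; ring
    · rw [Prod.snd_neg, Prod.fst_neg, h2]; ring
    · rw [Prod.snd_neg, Prod.snd_neg, h3]; ring

theorem hn_mem_lattice (a1 a2 a3 b1 b2 b3 : ℕ) (d1 d2 d3 : ℤ) :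
    (d1, d2, d3) ∈ hnLattice a1 a2 a3 b1 b2 b3 ↔
    ∃ α β : ℤ, d1 = α * (a1 + b1) - β * a1 ∧
    d2 = - α * b2 + β * (a2 + b2) ∧ d3 = - α * a3 - β * b3 := Iff.rfl

/-- Binomials with exponent difference in the lattice lie in the ideal. -/
theorem hn_binomial {k : Type*} [Field k] (a1 a2 a3 b1 b2 b3 : ℕ)
    (I : Ideal (MvPolynomial (Fin 3) k))
    (hI : I = Ideal.span {(X 0 : MvPolynomial (Fin 3) k) ^ (a1 + b1) - X 1 ^ b2 * X 2 ^ a3,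
      X 1 ^ (a2 + b2) - X 0 ^ a1 * X 2 ^ b3, X 2 ^ (a3 + b3) - X 0 ^ b1 * X 1 ^ a2})
    (u1 u2 u3 v1 v2 v3 : ℕ)
    (h : ((u1 : ℤ) - v1, (u2 : ℤ) - v2, (u3 : ℤ) - v3) ∈ hnLattice a1 a2 a3 b1 b2 b3) :
    (X 0 : MvPolynomial (Fin 3) k) ^ u1 * X 1 ^ u2 * X 2 ^ u3 - X 0 ^ v1 * X 1 ^ v2 * X 2 ^ v3
      ∈ I := by
  obtain ⟨α, β, e1, e2, e3⟩ := h
  rw [← Ideal.Quotient.eq]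
  simp only [map_mul, map_pow]
  refine hn_core_int _ _ _ a1 a2 a3 b1 b2 b3 ?_ ?_ ?_ α β _ _ _ _ _ _ e1 e2 e3
  all_goals
    simp only [← map_mul, ← map_pow]
    rw [Ideal.Quotient.eq, hI]
    exact Ideal.subset_span (by simp)

/-- If the ideal is prime then the lattice is saturated. -/
theorem hn_sat {k : Type*} [Field k] (a1 a2 a3 b1 b2 b3 : ℕ)
    (I : Ideal (MvPolynomial (Fin 3) k))
    (hI : I = Ideal.span {(X 0 : MvPolynomial (Fin 3) k) ^ (a1 + b1) - X 1 ^ b2 * X 2 ^ a3,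
      X 1 ^ (a2 + b2) - X 0 ^ a1 * X 2 ^ b3, X 2 ^ (a3 + b3) - X 0 ^ b1 * X 1 ^ a2})
    (hP : I.IsPrime) (u1 u2 u3 v1 v2 v3 n : ℕ) (hn : 0 < n)
    (h : ((n : ℤ) * (u1 - v1), (n : ℤ) * (u2 - v2), (n : ℤ) * (u3 - v3))
      ∈ hnLattice a1 a2 a3 b1 b2 b3) :
    ((u1 : ℤ) - v1, (u2 : ℤ) - v2, (u3 : ℤ) - v3) ∈ hnLattice a1 a2 a3 b1 b2 b3 := by
  let L := hnLattice a1 a2 a3 b1 b2 b3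
  let π : ℤ × ℤ × ℤ →+ (ℤ × ℤ × ℤ) ⧸ L := QuotientAddGroup.mk' L
  let g : Fin 3 → (ℤ × ℤ × ℤ) ⧸ L := ![π (1, 0, 0), π (0, 1, 0), π (0, 0, 1)]
  let φ := MvPolynomial.aeval (R := k) (fun i => (AddMonoidAlgebra.single (g i) (1 : k)))
  have hπ : ∀ d e : ℤ × ℤ × ℤ, π d = π e ↔ d - e ∈ L := by
    intro d e
    rw [← sub_eq_zero, ← map_sub]
    exact QuotientAddGroup.eq_zero_iff _
  have hφ : ∀ w1 w2 w3 : ℕ, φ (X 0 ^ w1 * X 1 ^ w2 * X 2 ^ w3) =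
      AddMonoidAlgebra.single (π ((w1 : ℤ), (w2 : ℤ), (w3 : ℤ))) 1 := by
    intro w1 w2 w3
    simp only [φ, map_mul, map_pow, aeval_X, AddMonoidAlgebra.single_pow, one_pow,
      AddMonoidAlgebra.single_mul_single, mul_one]
    congr 1
    simp [g, ← map_nsmul, ← map_add]
  have hbin : ∀ w1 w2 w3 z1 z2 z3 : ℕ,
      ((w1 : ℤ) - z1, (w2 : ℤ) - z2, (w3 : ℤ) - z3) ∈ L →
      φ (X 0 ^ w1 * X 1 ^ w2 * X 2 ^ w3 - X 0 ^ z1 * X 1 ^ z2 * X 2 ^ z3) = 0 := by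
    intro w1 w2 w3 z1 z2 z3 hw
    rw [map_sub, hφ, hφ, sub_eq_zero, (hπ (_, _, _) (_, _, _)).mpr hw]
  have hker : I ≤ RingHom.ker φ := by
    rw [hI, Ideal.span_le]
    rintro f (rfl | rfl | rfl)
    · have := hbin (a1 + b1) 0 0 0 b2 a3 ⟨1, 0, by simp⟩
      simpa using this
    · have := hbin 0 (a2 + b2) 0 a1 0 b3 ⟨0, 1, by simp⟩
      simpa using this
    · have := hbin 0 0 (a3 + b3) b1 a2 0 ⟨-1, -1, by push_cast; refine ⟨?_, ?_, ?_⟩ <;> ring⟩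
      simpa using this
  have := hn_tors g I hP (fun f hf => hker hf) (X 0 ^ u1 * X 1 ^ u2 * X 2 ^ u3)
    (X 0 ^ v1 * X 1 ^ v2 * X 2 ^ v3) _ _ (hφ u1 u2 u3) (hφ v1 v2 v3) ?_ n hn ?_
  · exact (hπ _ _).mp this
  · intro N hN
    rw [← map_nsmul, ← map_nsmul, hπ] at hN
    simp only [mul_pow, ← pow_mul]
    apply hn_binomial a1 a2 a3 b1 b2 b3 I hI
    convert hN using 1
    simp [mul_comm]
  · rw [← map_nsmul, ← map_nsmul, hπ]
    convert h using 1
    simp [mul_sub]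

/-- A product identity: elements of the lattice have cross product a multiple of `m`. -/
theorem hn_gcd (a1 a2 a3 b1 b2 b3 : ℕ) (m1 m2 m3 : ℕ)
    (hpos : 0 < m3)
    (h1 : (m1 : ℤ) = (a2 + b2) * (a3 + b3) - a2 * b3)
    (h2 : (m2 : ℤ) = (a1 + b1) * (a3 + b3) - a3 * b1)
    (h3 : (m3 : ℤ) = (a1 + b1) * (a2 + b2) - a1 * b2)
    (hs : ∀ u1 u2 u3 v1 v2 v3 n : ℕ, 0 < n →
      ((n : ℤ) * (u1 - v1), (n : ℤ) * (u2 - v2), (n : ℤ) * (u3 - v3))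
        ∈ hnLattice a1 a2 a3 b1 b2 b3 →
      ((u1 : ℤ) - v1, (u2 : ℤ) - v2, (u3 : ℤ) - v3) ∈ hnLattice a1 a2 a3 b1 b2 b3) :
    Nat.gcd m1 (Nat.gcd m2 m3) = 1 := by
  set d := Nat.gcd m1 (Nat.gcd m2 m3) with hd
  have hdpos : 0 < d := Nat.gcd_pos_of_pos_right _ (Nat.gcd_pos_of_pos_right _ hpos)
  obtain ⟨n1, hn1⟩ : d ∣ m1 := Nat.gcd_dvd_left _ _
  obtain ⟨n2, hn2⟩ : d ∣ m2 := (Nat.gcd_dvd_right _ _).trans (Nat.gcd_dvd_left _ _)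
  obtain ⟨n3, hn3⟩ : d ∣ m3 := (Nat.gcd_dvd_right _ _).trans (Nat.gcd_dvd_right _ _)
  have z1 : (m1 : ℤ) = d * n1 := by exact_mod_cast hn1
  have z2 : (m2 : ℤ) = d * n2 := by exact_mod_cast hn2
  have z3 : (m3 : ℤ) = d * n3 := by exact_mod_cast hn3
  have dz : (d : ℤ) ≠ 0 := by exact_mod_cast hdpos.ne'
  obtain ⟨α, β, p1, p2, p3⟩ := hs 0 n3 0 0 0 n2 d hdpos
    ⟨a1, a1 + b1, by push_cast; ring,
      by push_cast; linear_combination h3 - z3, by push_cast; linear_combination z2 - h2⟩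
  obtain ⟨α_b, β_b, q1, q2, q3⟩ := hs n3 0 0 0 0 n1 d hdpos
    ⟨a2 + b2, b2, by push_cast; linear_combination h3 - z3,
      by push_cast; ring, by push_cast; linear_combination z1 - h1⟩
  obtain ⟨α_c, β_c, r1, r2, r3⟩ := hs n2 0 0 0 n1 0 d hdpos
    ⟨b3, -a3, by push_cast; linear_combination h2 - z2,
      by push_cast; linear_combination z1 - h1, by push_cast; ring⟩
  push_cast at p1 p2 p3 q1 q2 q3 r1 r2 r3
  have aux : ∀ n K : ℤ, n * n = K * (d * n) → (d : ℤ) ∣ n := by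
    intro n K h
    rcases eq_or_ne n 0 with rfl | hn
    · exact dvd_zero _
    · exact ⟨K, mul_right_cancel₀ hn (by linear_combination h)⟩
  have k3 : (d : ℤ) ∣ n3 := by
    apply aux _ (α_b * β - α * β_b)
    rw [← z3, h3]
    linear_combination (n3 : ℤ) * p2 + (- α * b2 + β * (a2 + b2)) * q1
      - (- α_b * b2 + β_b * (a2 + b2)) * p1
  have k2 : (d : ℤ) ∣ n2 := by
    apply aux _ (α_c * β - α * β_c)
    rw [← z2, h2]
    linear_combination (-n2 : ℤ) * p3 - (- α * a3 - β * b3) * r1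
      + (- α_c * a3 - β_c * b3) * p1
  have k1 : (d : ℤ) ∣ n1 := by
    apply aux _ (α_c * β_b - α_b * β_c)
    rw [← z1, h1]
    linear_combination (-n1 : ℤ) * r2 + (- α_c * b2 + β_c * (a2 + b2)) * q3
      - (- α_c * a3 - β_c * b3) * q2
  rw [Int.natCast_dvd_natCast] at k1 k2 k3
  have hdd : d * d ∣ d := by
    conv_rhs => rw [hd]
    refine Nat.dvd_gcd ?_ (Nat.dvd_gcd ?_ ?_)
    · rw [hn1]; exact mul_dvd_mul_left d k1
    · rw [hn2]; exact mul_dvd_mul_left d k2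
    · rw [hn3]; exact mul_dvd_mul_left d k3
  have := Nat.le_of_dvd hdpos hdd
  nlinarith

theorem hn_span (a1 a2 a3 b1 b2 b3 : ℕ) (m1 m2 m3 : ℕ)
    (h1 : (m1 : ℤ) = (a2 + b2) * (a3 + b3) - a2 * b3)
    (h2 : (m2 : ℤ) = (a1 + b1) * (a3 + b3) - a3 * b1)
    (h3 : (m3 : ℤ) = (a1 + b1) * (a2 + b2) - a1 * b2)
    (hg : Nat.gcd m1 (Nat.gcd m2 m3) = 1) (d1 d2 d3 : ℤ)
    (hd : d1 * m1 + d2 * m2 + d3 * m3 = 0) :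
    (d1, d2, d3) ∈ hnLattice a1 a2 a3 b1 b2 b3 := by
  obtain ⟨p1, p2, p3, hp⟩ : ∃ p1 p2 p3 : ℤ, p1 * m1 + p2 * m2 + p3 * m3 = 1 := by
    have e1 := Nat.gcd_eq_gcd_ab m1 (Nat.gcd m2 m3)
    have e2 := Nat.gcd_eq_gcd_ab m2 m3
    rw [hg] at e1
    rw [e2] at e1
    refine ⟨m1.gcdA (m2.gcd m3), m2.gcdA m3 * m1.gcdB (m2.gcd m3),
      m2.gcdB m3 * m1.gcdB (m2.gcd m3), ?_⟩
    push_cast at e1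
    linear_combination -e1
  rw [hn_mem_lattice]
  rw [h1, h2, h3] at hd hp
  -- U = (c1, -b2, -a3), V = (-a1, c2, -b3)
  refine ⟨p1 * (d2 * (-b3) - d3 * (a2 + b2)) + p2 * (d3 * (-a1) - d1 * (-b3))
      + p3 * (d1 * (a2 + b2) - d2 * (-a1)),
    p1 * ((-b2) * d3 - (-a3) * d2) + p2 * ((-a3) * d1 - (a1 + b1) * d3)
      + p3 * ((a1 + b1) * d2 - (-b2) * d1), ?_, ?_, ?_⟩
  · linear_combination p1 * hd - d1 * hp
  · linear_combination p2 * hd - d2 * hp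
  · linear_combination p3 * hd - d3 * hp

/-- A Herzog–Northcott ideal `I` is prime iff `gcd(m1,m2,m3) = 1`, where
`(m1,m2,m3) = (c2·c3 − a2·b3, c1·c3 − a3·b1, c1·c2 − a1·b2)`; and in that case
`I` equals the Herzog ideal `𝔭_{(m1,m2,m3)}`. -/
theorem stmt_17 {k : Type*} [Field k]
    (a1 a2 a3 b1 b2 b3 c1 c2 c3 : ℕ)
    (ha1 : 0 < a1) (ha2 : 0 < a2) (ha3 : 0 < a3)
    (hb1 : 0 < b1) (hb2 : 0 < b2) (hb3 : 0 < b3)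
    (hc1 : c1 = a1 + b1) (hc2 : c2 = a2 + b2) (hc3 : c3 = a3 + b3)
    (I : Ideal (MvPolynomial (Fin 3) k))
    (hI : I = Ideal.span {(X 0 : MvPolynomial (Fin 3) k) ^ c1 - X 1 ^ b2 * X 2 ^ a3,
      X 1 ^ c2 - X 0 ^ a1 * X 2 ^ b3, X 2 ^ c3 - X 0 ^ b1 * X 1 ^ a2})
    (mI : Fin 3 → ℕ)
    (hmI : mI = ![c2 * c3 - a2 * b3, c1 * c3 - a3 * b1, c1 * c2 - a1 * b2]) :
    (I.IsPrime ↔ Nat.gcd (mI 0) (Nat.gcd (mI 1) (mI 2)) = 1) ∧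
    (I.IsPrime → I = herzogIdeal k mI) := by
  subst hc1 hc2 hc3
  have g0 : mI 0 = (a2 + b2) * (a3 + b3) - a2 * b3 := by rw [hmI]; rfl
  have g1 : mI 1 = (a1 + b1) * (a3 + b3) - a3 * b1 := by rw [hmI]; rfl
  have g2 : mI 2 = (a1 + b1) * (a2 + b2) - a1 * b2 := by rw [hmI]; rfl
  have h1 : (mI 0 : ℤ) = (a2 + b2) * (a3 + b3) - a2 * b3 := by
    rw [g0, Nat.cast_sub (Nat.mul_le_mul (by omega) (by omega))]; push_cast; ring
  have h2 : (mI 1 : ℤ) = (a1 + b1) * (a3 + b3) - a3 * b1 := by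
    have hle : a3 * b1 ≤ (a1 + b1) * (a3 + b3) := by
      rw [mul_comm a3]; exact Nat.mul_le_mul (by omega) (by omega)
    rw [g1, Nat.cast_sub hle]; push_cast; ring
  have h3 : (mI 2 : ℤ) = (a1 + b1) * (a2 + b2) - a1 * b2 := by
    rw [g2, Nat.cast_sub (Nat.mul_le_mul (by omega) (by omega))]; push_cast; ring
  have hpos : 0 < mI 2 := by
    have : (0 : ℤ) < mI 2 := by
      rw [h3]
      have : (0 : ℤ) < a1 * a2 := by positivity
      have : (0 : ℤ) < b1 * (a2 + b2) := by positivity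
      linarith
    exact_mod_cast this
  have hfwd : I.IsPrime → Nat.gcd (mI 0) (Nat.gcd (mI 1) (mI 2)) = 1 := fun hP =>
    hn_gcd a1 a2 a3 b1 b2 b3 _ _ _ hpos h1 h2 h3
      (fun u1 u2 u3 v1 v2 v3 n => hn_sat a1 a2 a3 b1 b2 b3 I hI hP u1 u2 u3 v1 v2 v3 n)
  have heq : Nat.gcd (mI 0) (Nat.gcd (mI 1) (mI 2)) = 1 → I = herzogIdeal k mI := by
    intro hg
    apply le_antisymm
    · rw [hI, Ideal.span_le]
      have hmem : ∀ f, f ∈ herzogIdeal k mI ↔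
        MvPolynomial.aeval (fun i => (Polynomial.X : Polynomial k) ^ mI i) f = 0 := fun _ => Iff.rfl
      rintro f (rfl | rfl | rfl)
      all_goals
        rw [SetLike.mem_coe, hmem]
        simp only [map_sub, map_mul, map_pow, aeval_X, ← pow_mul, ← pow_add]
        rw [sub_eq_zero]
        congr 1
        zify
        rw [h1, h2, h3]
        ring
    · apply hn_ker_le
      intro u v huv
      have hmon : ∀ w : Fin 3 →₀ ℕ, (monomial w (1 : k)) =
          X 0 ^ w 0 * X 1 ^ w 1 * X 2 ^ w 2 := by
        intro w
        rw [monomial_eq, Finsupp.prod_fintype _ _ (by simp)]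
        simp [Fin.prod_univ_three]
      rw [hmon, hmon]
      apply hn_binomial a1 a2 a3 b1 b2 b3 I hI
      apply hn_span a1 a2 a3 b1 b2 b3 _ _ _ h1 h2 h3 hg
      zify at huv
      linear_combination huv
  refine ⟨⟨hfwd, fun hg => ?_⟩, fun hP => heq (hfwd hP)⟩
  rw [heq hg]
  exact RingHom.ker_isPrime _
end
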